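/- Let σ : Bool → Bool → ℝ be a stochastic map on bits, i.e., σ(y|x) ≥ 0 for all x, y and ∑_y σ(y|x) = 1 for each x. Then: (a) every probability distribution P over bit functions that induces σ (meaning σ(y|x) = ∑_{f : f(x) = y} P(f) for all x, y) satisfies P(I) + P(F) ≥ |σ(true|true) − σ(true|false)|; and (b) there exists a probability distribution P over bit functions inducing σ with P(I) + P(F) = |σ(true|true) − σ(true|false)|. Thus |ACE(σ)| is the minimum probability of causal connection M_β over all distributions over functions realizing σ. -/

import Mathlib

open Finset

/-- `P` is a probability distribution over the four bit functions. -/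
def IsDist (P : (Bool → Bool) → ℝ) : Prop :=
  (∀ f, 0 ≤ P f) ∧ ∑ f : Bool → Bool, P f = 1

/-- `μ` is a probability distribution over pairs (pre-processing, post-processing),
specifying a free operation. -/
def IsFreeOp (μ : ((Bool → Bool) × (Bool → Bool)) → ℝ) : Prop :=
  (∀ gh, 0 ≤ μ gh) ∧ ∑ gh : (Bool → Bool) × (Bool → Bool), μ gh = 1

/-- The action `Γ_μ` of a free operation `μ` on a distribution `P` over bit functions:
`Γ_μ(P)(f') = ∑_{(g,h)} μ(g,h) · ∑_{f : h ∘ f ∘ g = f'} P(f)`. -/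
noncomputable def Gamma (μ : ((Bool → Bool) × (Bool → Bool)) → ℝ)
    (P : (Bool → Bool) → ℝ) : (Bool → Bool) → ℝ :=
  fun f' => ∑ gh : (Bool → Bool) × (Bool → Bool),
    μ gh * ∑ f : Bool → Bool, if gh.2 ∘ f ∘ gh.1 = f' then P f else 0

/-- The identity bit function `I`. -/
def bitI : Bool → Bool := id
/-- The flip bit function `F`. -/
def bitF : Bool → Bool := fun b => !b
/-- The reset-to-zero bit function `R0`. -/
def bitR0 : Bool → Bool := fun _ => false
/-- The reset-to-one bit function `R1`. -/
def bitR1 : Bool → Bool := fun _ => true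

theorem sum_bit (g : (Bool → Bool) → ℝ) :
    ∑ f : Bool → Bool, g f = g bitI + g bitF + g bitR0 + g bitR1 := by
  have h : (Finset.univ : Finset (Bool → Bool)) = {bitI, bitF, bitR0, bitR1} := by decide
  rw [h, Finset.sum_insert (by decide), Finset.sum_insert (by decide),
    Finset.sum_insert (by decide), Finset.sum_singleton]
  ring

/-- for a stochastic map `σ` on bits, (a) every distribution over bit
functions inducing `σ` has `M_β(P) = P(I)+P(F) ≥ |ACE(σ)|`, and (b) some distribution
inducing `σ` attains `P(I)+P(F) = |ACE(σ)|`. -/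
theorem stmt_13 (σ : Bool → Bool → ℝ)
    (hσ0 : ∀ y x, 0 ≤ σ y x) (hσ1 : ∀ x, ∑ y : Bool, σ y x = 1) :
    (∀ P : (Bool → Bool) → ℝ, IsDist P →
        (∀ x y, σ y x = ∑ f : Bool → Bool, if f x = y then P f else 0) →
        |σ true true - σ true false| ≤ P bitI + P bitF) ∧
    (∃ P : (Bool → Bool) → ℝ, IsDist P ∧
        (∀ x y, σ y x = ∑ f : Bool → Bool, if f x = y then P f else 0) ∧
        P bitI + P bitF = |σ true true - σ true false|) := by
  constructor
  · rintro P ⟨h0, -⟩ h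
    have h1 := h true true
    have h2 := h false true
    rw [sum_bit] at h1 h2
    simp [bitI, bitF, bitR0, bitR1] at h1 h2
    have hI := h0 bitI
    have hF := h0 bitF
    unfold bitI bitF at *
    rw [abs_le]
    constructor <;> linarith
  · have ht := hσ1 true
    have hf := hσ1 false
    simp only [Fintype.sum_bool] at ht hf
    have a1 := hσ0 true true
    have a2 := hσ0 true false
    have a3 := hσ0 false true
    have a4 := hσ0 false false
    refine ⟨fun f => if f true then
        (if f false then min (σ true true) (σ true false)
          else max (σ true true) (σ true false) - σ true false)
        else (if f false then max (σ true true) (σ true false) - σ true true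
          else 1 - max (σ true true) (σ true false)), ⟨?_, ?_⟩, ?_, ?_⟩
    · intro f
      dsimp only
      rcases le_total (σ true true) (σ true false) with h | h <;>
        simp only [h, max_eq_left, max_eq_right, min_eq_left, min_eq_right] <;>
        split_ifs <;> linarith
    · rw [sum_bit]
      rcases le_total (σ true true) (σ true false) with h | h <;>
        simp [bitI, bitF, bitR0, bitR1, h]
    · intro x y
      rw [sum_bit]
      rcases le_total (σ true true) (σ true false) with h | h <;>
        cases x <;> cases y <;> simp [bitI, bitF, bitR0, bitR1, h] <;> linarith
    · rcases le_total (σ true true) (σ true false) with h | h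
      · rw [abs_of_nonpos (by linarith)]
        simp [bitI, bitF, h]
      · rw [abs_of_nonneg (by linarith)]
        simp [bitI, bitF, h]
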